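/- Let v_−, x_− ∈ ℝⁿ with v_−·x_− = 0 and |v_−| ≥ μ, let 0 < r < min(|v_−|/2^{3/2}, 1), and let y_− ∈ M_r satisfy A(y_−) = y_−. Then: (i) x(t) := z_−(v_−,t) + x_− + y_−(t) is a C² solution of ẍ = F(x) on ℝ; (ii) the integral a := v_− + ∫_{−∞}^{∞} F(z_−(v_−,τ)+x_−+y_−(τ)) dτ converges absolutely and |a| = |v_−| (in particular z_+(a,·) is defined); (iii) the improper integrals defining l, l₁, l₂, y_+ below converge absolutely and for every t ≥ 0, z_−(v_−,t)+x_−+y_−(t) = z_+(a,t) + b + y_+(t), where b := x_− + l + l₁ + l₂, l := ∫_{−∞}^0 ∫_{−∞}^σ (F(z_−(v_−,τ)+x_−+y_−(τ)) − F^l(z_−(v_−,τ))) dτ dσ − ∫_0^∞ ∫_σ^∞ F^s(z_−(v_−,τ)+x_−+y_−(τ)) dτ dσ, l₁ := −∫_0^∞ ∫_σ^∞ (F^l(z_+(a,τ)+x_−) − F^l(z_+(a,τ))) dτ dσ, l₂ := −∫_0^∞ ∫_σ^∞ (F^l(z_−(v_−,τ)+x_−+y_−(τ)) − F^l(z_+(a,τ)+x_−))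 dτ dσ, and y_+(t) := ∫_t^∞ ∫_σ^∞ (F(z_−(v_−,τ)+x_−+y_−(τ)) − F^l(z_+(a,τ))) dτ dσ. -/

import Mathlib

open MeasureTheory Real Filter Set Topology RealInnerProductSpace

noncomputable section

namespace Paper

/-- ℝⁿ -/
abbrev Euc (n : ℕ) : Type := EuclideanSpace ℝ (Fin n)

variable {n : ℕ}

/-- the norm `sup_{t ≤ 0} ‖f t‖ + sup_{t ≥ 0} ‖f t‖/(1+t)` on the space `M_r`. -/
def Mnorm (f : ℝ → Euc n) : ℝ :=
  sSup ((fun t => ‖f t‖) '' Iic 0) + sSup ((fun t => ‖f t‖ / (1 + t)) '' Ici 0)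

/-- membership in the complete metric space `M_r`. -/
def MemM (r : ℝ) (f : ℝ → Euc n) : Prop :=
  Continuous f ∧ BddAbove ((fun t => ‖f t‖) '' Iic 0) ∧
    BddAbove ((fun t => ‖f t‖ / (1 + t)) '' Ici 0) ∧ Mnorm f ≤ r

/-- the long range decay conditions on `V^l`. -/
def LongRange (α βl0 βl1 βl2 : ℝ) (Vl : Euc n → ℝ) : Prop :=
  ContDiff ℝ 2 Vl ∧
    (∀ x, |Vl x| ≤ βl0 * (1 + ‖x‖) ^ (-α)) ∧
    (∀ x, ‖gradient Vl x‖ ≤ βl1 * (1 + ‖x‖) ^ (-(α + 1))) ∧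
    (∀ x, ‖iteratedFDeriv ℝ 2 Vl x‖ ≤ βl2 * (1 + ‖x‖) ^ (-(α + 2)))

/-- the short range decay conditions on `V^s`. -/
def ShortRange (α βs1 βs2 βs3 : ℝ) (Vs : Euc n → ℝ) : Prop :=
  ContDiff ℝ 2 Vs ∧
    (∀ x, |Vs x| ≤ βs1 * (1 + ‖x‖) ^ (-(α + 1))) ∧
    (∀ x, ‖gradient Vs x‖ ≤ βs2 * (1 + ‖x‖) ^ (-(α + 2))) ∧
    (∀ x, ‖iteratedFDeriv ℝ 2 Vs x‖ ≤ βs3 * (1 + ‖x‖) ^ (-(α + 3)))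

/-- `z` is a C² solution of `z'' = Fl ∘ z` with `z 0 = x0`, `z' → w` along the filter `l`
(`atBot` for `z_-`, `atTop` for `z_+`), satisfying the growth bound `‖z t - x0 - t w‖ ≤ C |t|`. -/
def IsFreeSol (Fl : Euc n → Euc n) (x0 w : Euc n) (l : Filter ℝ) (C : ℝ)
    (z : ℝ → Euc n) : Prop :=
  ContDiff ℝ 2 z ∧ (∀ t, deriv (deriv z) t = Fl (z t)) ∧ z 0 = x0 ∧
    Tendsto (fun t => deriv z t) l (𝓝 w) ∧ ∀ t, ‖z t - x0 - t • w‖ ≤ C * |t|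

/-- the map `A` (or `𝒜` when `xm = 0` and `zm` already contains the base point). -/
def Aop (Fl F : Euc n → Euc n) (zm : ℝ → Euc n) (xm : Euc n)
    (f : ℝ → Euc n) (t : ℝ) : Euc n :=
  ∫ σ in Iic t, ∫ τ in Iic σ, (F (zm τ + xm + f τ) - Fl (zm τ))

/-- the vector `l(v_-,x_-,y_-)`. -/
def lInt (Fl Fs F : Euc n → Euc n) (zm : ℝ → Euc n) (xm : Euc n) (ym : ℝ → Euc n) : Euc n :=
  (∫ σ in Iic (0:ℝ), ∫ τ in Iic σ, (F (zm τ + xm + ym τ) - Fl (zm τ))) -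
    ∫ σ in Ici (0:ℝ), ∫ τ in Ici σ, Fs (zm τ + xm + ym τ)

/-- the vector `l₁(v_-,x_-)`. -/
def l1Int (Fl : Euc n → Euc n) (zp : ℝ → Euc n) (xm : Euc n) : Euc n :=
  -∫ σ in Ici (0:ℝ), ∫ τ in Ici σ, (Fl (zp τ + xm) - Fl (zp τ))

/-- the vector `l₂(v_-,x_-,y_-)`. -/
def l2Int (Fl : Euc n → Euc n) (zm zp : ℝ → Euc n) (xm : Euc n) (ym : ℝ → Euc n) : Euc n :=
  -∫ σ in Ici (0:ℝ), ∫ τ in Ici σ, (Fl (zm τ + xm + ym τ) - Fl (zp τ + xm))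

/-- the function `y_+`. -/
def yplusInt (Fl F : Euc n → Euc n) (zm zp : ℝ → Euc n) (xm : Euc n) (ym : ℝ → Euc n)
    (t : ℝ) : Euc n :=
  ∫ σ in Ici t, ∫ τ in Ici σ, (F (zm τ + xm + ym τ) - Fl (zp τ))

/-- the vector `W(v_-,x_-)`. -/
def Wvec (Fl : Euc n → Euc n) (zm zp : ℝ → Euc n) (xm : Euc n) : Euc n :=
  (∫ σ in Iic (0:ℝ), ∫ τ in Iic σ, (Fl (zm τ + xm) - Fl (zm τ))) -
    ∫ σ in Ici (0:ℝ), ∫ τ in Ici σ, (Fl (zp τ + xm) - Fl (zp τ))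

/-- the map `𝒢_{v_-,x_-}`; here `zm = z_-(v_-,x_-,·)` contains the base point `x_-`
and `zp h = z_+(ã, x_- + h, ·)`. -/
def Gmap (Fl Fs F : Euc n → Euc n) (zm : ℝ → Euc n) (zp : Euc n → ℝ → Euc n)
    (ym : ℝ → Euc n) (h : Euc n) : Euc n :=
  lInt Fl Fs F zm 0 ym -
    ∫ σ in Ici (0:ℝ), ∫ τ in Ici σ, (Fl (zm τ + ym τ) - Fl (zp h τ))

/-- the vector `W̃(v_-,x_-)`; here `zp0 = z_+(ã, x_-, ·)`. -/
def Wtilde (Fl : Euc n → Euc n) (zm zp0 : ℝ → Euc n) : Euc n :=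
  (∫ τ in Iic (0:ℝ), Fl (zm τ)) + ∫ τ in Ici (0:ℝ), Fl (zp0 τ)

section Calculus

variable {E : Type*} [NormedAddCommGroup E] {g : ℝ → E} {C p s : ℝ}

theorem integrable_of_norm_le_rpow (hg : Continuous g) (hp : 1 < p)
    (h : ∀ t, ‖g t‖ ≤ C * (1 + |t|) ^ (-p)) : Integrable g := by
  have h1 : Integrable (fun t : ℝ => (1 + ‖t‖) ^ (-p)) :=
    integrable_one_add_norm (by simpa using hp)
  exact (h1.const_mul C).mono' hg.aestronglyMeasurable (Eventually.of_forall h)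

theorem integrableOn_Ici_of_norm_le_rpow (hg : Continuous g) (hp : 1 < p)
    (h : ∀ t, 0 ≤ t → ‖g t‖ ≤ C * (1 + |t|) ^ (-p)) (σ : ℝ) : IntegrableOn g (Ici σ) := by
  have h1 : Integrable (fun t : ℝ => (1 + ‖t‖) ^ (-p)) :=
    integrable_one_add_norm (by simpa using hp)
  have h0 : IntegrableOn g (Ici 0) :=
    (h1.const_mul C).integrableOn.mono' hg.aestronglyMeasurable
      ((ae_restrict_iff' measurableSet_Ici).2 (Eventually.of_forall fun t ht => h t ht))
  refine ((hg.integrableOn_Icc (a := σ) (b := 0)).union h0).mono_set fun t ht => ?_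
  rcases le_total t 0 with h | h
  · exact Or.inl ⟨ht, h⟩
  · exact Or.inr h

theorem hasDerivAt_one_add_rpow {t : ℝ} (ht : 0 ≤ t) (s : ℝ) :
    HasDerivAt (fun t : ℝ => (1 + t) ^ (-s)) (-s * (1 + t) ^ (-(s + 1))) t := by
  have := ((hasDerivAt_id t).const_add 1).rpow_const (p := -s) (Or.inl (by simp; linarith))
  convert! this using 1
  simp only [id, one_mul]
  ring_nf

theorem tendsto_one_add_abs_rpow (hs : 0 < s) {l : Filter ℝ} (hl : Tendsto (|·|) l atTop) :
    Tendsto (fun t : ℝ => (1 + |t|) ^ (-s)) l (𝓝 0) :=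
  (tendsto_rpow_neg_atTop hs).comp (tendsto_atTop_add_const_left _ _ hl)

theorem integrableOn_Iic_of_comp_neg {σ : ℝ} (h : IntegrableOn (fun t => g (-t)) (Ici (-σ))) :
    IntegrableOn g (Iic σ) := by
  simpa using IntegrableOn.comp_neg_Iic (c := σ) h

theorem norm_comp_neg_le_rpow (h : ∀ t ≤ 0, ‖g t‖ ≤ C * (1 + |t|) ^ (-p)) (t : ℝ)
    (ht : 0 ≤ t) : ‖g (-t)‖ ≤ C * (1 + |t|) ^ (-p) := by
  simpa using h (-t) (by linarith)

theorem integrableOn_Iic_of_norm_le_rpow (hg : Continuous g) (hp : 1 < p)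
    (h : ∀ t ≤ 0, ‖g t‖ ≤ C * (1 + |t|) ^ (-p)) (σ : ℝ) : IntegrableOn g (Iic σ) :=
  integrableOn_Iic_of_comp_neg (integrableOn_Ici_of_norm_le_rpow (hg.comp continuous_neg) hp
    (norm_comp_neg_le_rpow h) _)

variable [NormedSpace ℝ E]

theorem integral_add_add {X : Type*} [MeasurableSpace X] {μ : Measure X} {f₁ f₂ f₃ : X → E}
    (h₁ : Integrable f₁ μ) (h₂ : Integrable f₂ μ) (h₃ : Integrable f₃ μ) :
    ∫ x, (f₁ x + (f₂ x + f₃ x)) ∂μ = ∫ x, f₁ x ∂μ + (∫ x, f₂ x ∂μ + ∫ x, f₃ x ∂μ) := by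
  rw [← integral_add h₂ h₃]
  exact integral_add h₁ (h₂.add h₃)

theorem contDiff_two_of_hasDerivAt {f f' f'' : ℝ → E} (hf : ∀ t, HasDerivAt f (f' t) t)
    (hf' : ∀ t, HasDerivAt f' (f'' t) t) (hf'' : Continuous f'') : ContDiff ℝ 2 f := by
  have e : deriv f = f' := funext fun t => (hf t).deriv
  have e' : deriv f' = f'' := funext fun t => (hf' t).deriv
  rw [show (2 : WithTop ℕ∞) = 1 + 1 by norm_num, contDiff_succ_iff_deriv, e,
    contDiff_one_iff_deriv, e']
  exact ⟨fun t => (hf t).differentiableAt, by simp, fun t => (hf' t).differentiableAt, hf''⟩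

theorem integral_Ici_rpow (hs : 0 < s) (C : ℝ) {σ : ℝ} (hσ : 0 ≤ σ) :
    ∫ τ in Ici σ, C * (1 + |τ|) ^ (-(s + 1)) = C / s * (1 + |σ|) ^ (-s) := by
  have h1 : Integrable (fun t : ℝ => C * (1 + |t|) ^ (-(s + 1))) :=
    (integrable_one_add_norm (by simpa using hs)).const_mul C
  have hd : ∀ t ∈ Ici σ, HasDerivAt (fun t : ℝ => -(C / s) * (1 + t) ^ (-s))
      (C * (1 + |t|) ^ (-(s + 1))) t := by
    intro t ht
    have ht0 : 0 ≤ t := hσ.trans ht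
    refine ((hasDerivAt_one_add_rpow ht0 s).const_mul (-(C / s))).congr_deriv ?_
    rw [abs_of_nonneg ht0]
    field_simp
  have hlim : Tendsto (fun t : ℝ => -(C / s) * (1 + t) ^ (-s)) atTop (𝓝 0) := by
    simpa using ((tendsto_rpow_neg_atTop hs).comp
      (tendsto_atTop_add_const_left atTop (1 : ℝ) tendsto_id)).const_mul (-(C / s))
  rw [integral_Ici_eq_integral_Ioi,
    integral_Ioi_of_hasDerivAt_of_tendsto' hd h1.integrableOn hlim, abs_of_nonneg hσ]
  ring

theorem norm_integral_Ici_le_rpow (hs : 0 < s)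
    (h : ∀ t, 0 ≤ t → ‖g t‖ ≤ C * (1 + |t|) ^ (-(s + 1))) {σ : ℝ} (hσ : 0 ≤ σ) :
    ‖∫ τ in Ici σ, g τ‖ ≤ C / s * (1 + |σ|) ^ (-s) := by
  rw [← integral_Ici_rpow hs C hσ]
  exact norm_integral_le_of_norm_le
    ((integrable_one_add_norm (by simpa using hs)).const_mul C).integrableOn
    ((ae_restrict_iff' measurableSet_Ici).2 (Eventually.of_forall fun t ht => h t (hσ.trans ht)))

theorem integral_Ici_eq_add_intervalIntegral (hg : ∀ σ, IntegrableOn g (Ici σ)) (σ τ : ℝ) :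
    ∫ t in Ici σ, g t = (∫ t in σ..τ, g t) + ∫ t in Ici τ, g t := by
  simp only [integral_Ici_eq_integral_Ioi]
  exact (intervalIntegral.integral_interval_add_Ioi ((hg σ).mono_set Ioi_subset_Ici_self)
    ((hg τ).mono_set Ioi_subset_Ici_self)).symm

theorem hasDerivAt_integral_Ici [CompleteSpace E] (hg : Continuous g)
    (hi : ∀ σ, IntegrableOn g (Ici σ)) (σ : ℝ) :
    HasDerivAt (fun σ => ∫ t in Ici σ, g t) (-g σ) σ := by
  have h := (intervalIntegral.integral_hasDerivAt_right (hg.intervalIntegrable 0 σ)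
    (hg.stronglyMeasurableAtFilter _ _) hg.continuousAt).const_sub (∫ t in Ici 0, g t)
  refine h.congr_of_eventuallyEq (Eventually.of_forall fun τ => ?_)
  simp [integral_Ici_eq_add_intervalIntegral hi 0 τ]

theorem continuous_integral_Ici [CompleteSpace E] (hg : Continuous g)
    (hi : ∀ σ, IntegrableOn g (Ici σ)) : Continuous fun σ => ∫ t in Ici σ, g t :=
  continuous_iff_continuousAt.2 fun σ => (hasDerivAt_integral_Ici hg hi σ).continuousAt

theorem integrableOn_Ici_integral_Ici [CompleteSpace E] (hg : Continuous g) (hp : 2 < p)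
    (h : ∀ t, 0 ≤ t → ‖g t‖ ≤ C * (1 + |t|) ^ (-p)) (σ : ℝ) :
    IntegrableOn (fun σ => ∫ t in Ici σ, g t) (Ici σ) := by
  refine integrableOn_Ici_of_norm_le_rpow (C := C / (p - 1)) (p := p - 1)
    (continuous_integral_Ici hg (integrableOn_Ici_of_norm_le_rpow hg (by linarith) h))
    (by linarith) (fun t ht => ?_) σ
  exact norm_integral_Ici_le_rpow (by linarith) (by simpa using h) ht

theorem tendsto_integral_Ici_atTop (hp : 1 < p)
    (h : ∀ t, 0 ≤ t → ‖g t‖ ≤ C * (1 + |t|) ^ (-p)) :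
    Tendsto (fun σ => ∫ t in Ici σ, g t) atTop (𝓝 0) := by
  have hs : 0 < p - 1 := by linarith
  refine squeeze_zero_norm' (a := fun σ => C / (p - 1) * (1 + |σ|) ^ (-(p - 1)))
    ((eventually_ge_atTop 0).mono fun σ hσ =>
      norm_integral_Ici_le_rpow hs (by simpa using h) hσ) ?_
  simpa using (tendsto_one_add_abs_rpow hs tendsto_abs_atTop_atTop).const_mul (C / (p - 1))

theorem integral_Iic_eq_integral_Ici_comp_neg (σ : ℝ) :
    ∫ t in Iic σ, g t = ∫ t in Ici (-σ), g (-t) := by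
  rw [integral_Ici_eq_integral_Ioi, integral_comp_neg_Ioi, neg_neg]

theorem hasDerivAt_integral_Iic [CompleteSpace E] (hg : Continuous g)
    (hi : ∀ σ, IntegrableOn g (Iic σ)) (σ : ℝ) :
    HasDerivAt (fun σ => ∫ t in Iic σ, g t) (g σ) σ := by
  have h := (intervalIntegral.integral_hasDerivAt_right (hg.intervalIntegrable 0 σ)
    (hg.stronglyMeasurableAtFilter _ _) hg.continuousAt).const_add (∫ t in Iic 0, g t)
  refine h.congr_of_eventuallyEq (Eventually.of_forall fun τ => ?_)
  simp [← intervalIntegral.integral_Iic_sub_Iic (hi 0) (hi τ)]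

theorem continuous_integral_Iic [CompleteSpace E] (hg : Continuous g)
    (hi : ∀ σ, IntegrableOn g (Iic σ)) : Continuous fun σ => ∫ t in Iic σ, g t :=
  continuous_iff_continuousAt.2 fun σ => (hasDerivAt_integral_Iic hg hi σ).continuousAt

theorem integrableOn_Iic_integral_Iic [CompleteSpace E] (hg : Continuous g) (hp : 2 < p)
    (h : ∀ t ≤ 0, ‖g t‖ ≤ C * (1 + |t|) ^ (-p)) (σ : ℝ) :
    IntegrableOn (fun σ => ∫ t in Iic σ, g t) (Iic σ) := by
  refine integrableOn_Iic_of_comp_neg ?_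
  simpa [integral_Iic_eq_integral_Ici_comp_neg] using
    integrableOn_Ici_integral_Ici (hg.comp continuous_neg) hp (norm_comp_neg_le_rpow h) (-σ)

theorem tendsto_integral_Iic_atBot (hp : 1 < p)
    (h : ∀ t ≤ 0, ‖g t‖ ≤ C * (1 + |t|) ^ (-p)) :
    Tendsto (fun σ => ∫ t in Iic σ, g t) atBot (𝓝 0) := by
  simpa [Function.comp_def, integral_Iic_eq_integral_Ici_comp_neg] using
    (tendsto_integral_Ici_atTop hp (norm_comp_neg_le_rpow h)).comp tendsto_neg_atBot_atTop

/-- A function tending to `0` at `+∞` is recovered from its derivative. -/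
theorem eq_neg_integral_Ici_of_tendsto_zero [CompleteSpace E] {f : ℝ → E}
    (hf : ∀ t, HasDerivAt f (g t) t) (hi : ∀ σ, IntegrableOn g (Ici σ))
    (hlim : Tendsto f atTop (𝓝 0)) (t : ℝ) : f t = -∫ τ in Ici t, g τ := by
  rw [integral_Ici_eq_integral_Ioi, integral_Ioi_of_hasDerivAt_of_tendsto' (fun x _ => hf x)
    ((hi t).mono_set Ioi_subset_Ici_self) hlim]
  simp

/-- A trajectory whose velocity tends to `w` stays in a narrow cone around `t • w`. -/
theorem exists_norm_sub_smul_le_of_tendsto {f f' : ℝ → E} {w : E} {ε : ℝ} (hε : 0 < ε)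
    (hf : ∀ t, HasDerivAt f (f' t) t) (hlim : Tendsto f' atTop (𝓝 w)) :
    ∃ C, 0 ≤ C ∧ ∀ t, 0 ≤ t → ‖f t - t • w‖ ≤ ε * |t| + C := by
  have hd : ∀ t, HasDerivAt (fun t => f t - t • w) (f' t - w) t := fun t => by
    simpa [Pi.sub_def] using (hf t).sub ((hasDerivAt_id t).smul_const w)
  obtain ⟨T, hT⟩ := eventually_atTop.1
    ((tendsto_iff_norm_sub_tendsto_zero.1 hlim).eventually (gt_mem_nhds hε))
  have hcont : Continuous fun t => f t - t • w :=
    continuous_iff_continuousAt.2 fun t => (hd t).continuousAt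
  obtain ⟨C, hC⟩ := (isCompact_Icc (a := 0) (b := max T 0)).exists_bound_of_continuousOn
    hcont.continuousOn
  have hC0 : 0 ≤ C := (norm_nonneg _).trans (hC _ ⟨le_max_right _ _, le_rfl⟩)
  refine ⟨C, hC0, fun t ht => ?_⟩
  rw [abs_of_nonneg ht]
  rcases le_total t (max T 0) with h | h
  · have := hC t ⟨ht, h⟩
    nlinarith [mul_nonneg hε.le ht]
  · have h1 := (convex_Ici (max T 0)).norm_image_sub_le_of_norm_hasDerivWithin_le
      (fun x _ => (hd x).hasDerivWithinAt)
      (fun x hx => (hT x ((le_max_left _ _).trans hx)).le) (mem_Ici.2 le_rfl) (mem_Ici.2 h)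
    rw [Real.norm_of_nonneg (sub_nonneg.2 h)] at h1
    have h2 := hC _ (right_mem_Icc.2 (le_max_right T 0))
    have h3 := norm_le_norm_add_norm_sub' (f t - t • w) (f (max T 0) - max T 0 • w)
    nlinarith [mul_nonneg hε.le (le_max_right T 0)]

/-- A function with at most linear growth, whose derivative tends to `0` and whose second
derivative is controlled by the function itself with a short range weight, is bounded. -/
theorem exists_norm_le_of_second_deriv_le [CompleteSpace E] {f f' : ℝ → E} {A B K α : ℝ}
    (hα : 0 < α) (hf : ∀ t, HasDerivAt f (f' t) t) (hf' : ∀ t, HasDerivAt f' (g t) t)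
    (hg : Continuous g) (hlim : Tendsto f' atTop (𝓝 0)) (hA : 0 ≤ A) (hB : 0 ≤ B) (hK : 0 ≤ K)
    (hlin : ∀ t, 0 ≤ t → ‖f t‖ ≤ A + B * (1 + |t|))
    (hbd : ∀ t, 0 ≤ t → ‖g t‖ ≤ K * (1 + |t|) ^ (-(α + 2)) * (1 + ‖f t‖)) :
    ∃ D, 0 ≤ D ∧ ∀ t, 0 ≤ t → ‖f t‖ ≤ D := by
  have hcf : Continuous f := continuous_iff_continuousAt.2 fun t => (hf t).continuousAt
  obtain ⟨T, hT0, hT⟩ : ∃ T, 0 ≤ T ∧ K / α * (1 + T) ^ (-α) ≤ 1 / 2 := by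
    have h := (tendsto_one_add_abs_rpow hα tendsto_abs_atTop_atTop).const_mul (K / α)
    rw [mul_zero] at h
    obtain ⟨T, h1, h2⟩ := ((h.eventually (gt_mem_nhds (by norm_num : (0 : ℝ) < 1 / 2))).and
      (eventually_ge_atTop 0)).exists
    exact ⟨T, h2, by simpa [abs_of_nonneg h2] using h1.le⟩
  have hint : ∀ σ, IntegrableOn g (Ici σ) := by
    refine integrableOn_Ici_of_norm_le_rpow hg (p := α + 1) (C := K * (1 + A + B)) (by linarith)
      fun t ht => (hbd t ht).trans ?_
    have ht0 : 0 < 1 + |t| := by positivity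
    have e : (1 + |t|) ^ (-(α + 1)) = (1 + |t|) ^ (-(α + 2)) * (1 + |t|) := by
      rw [← rpow_add_one ht0.ne']; ring_nf
    rw [e]
    have h3 : 0 ≤ K * (1 + |t|) ^ (-(α + 2)) := by positivity
    have h4 : 1 + ‖f t‖ ≤ (1 + A + B) * (1 + |t|) := by
      have := hlin t ht
      nlinarith [mul_nonneg hA (abs_nonneg t), abs_nonneg t]
    calc _ ≤ K * (1 + |t|) ^ (-(α + 2)) * ((1 + A + B) * (1 + |t|)) := by gcongr
      _ = _ := by ring
  have step : ∀ A B : ℝ, 0 ≤ A → 0 ≤ B → (∀ t, T ≤ t → ‖f t‖ ≤ A + B * (1 + |t|)) →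
      ∀ t, T ≤ t → ‖f t‖ ≤ (‖f T‖ + 1 / 2 + A / 2) + B / 2 * (1 + |t|) := by
    intro A B hA hB hAB
    have hf'bd : ∀ t, T ≤ t → ‖f' t‖ ≤ K * (1 + A) * (1 + t) ^ (-(α + 1)) + B / 2 := by
      intro t ht
      have ht0 : 0 ≤ t := hT0.trans ht
      have hi : ∀ p C : ℝ, 1 < p → Integrable (fun t : ℝ => C * (1 + |t|) ^ (-p)) := fun p C hp =>
        (integrable_one_add_norm (by simpa using hp)).const_mul C
      have h1 : ∫ τ in Ici t, (K * (1 + A) * (1 + |τ|) ^ (-(α + 1 + 1)) +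
          K * B * (1 + |τ|) ^ (-(α + 1))) =
          K * (1 + A) / (α + 1) * (1 + |t|) ^ (-(α + 1)) + K * B / α * (1 + |t|) ^ (-α) := by
        rw [integral_add (hi _ _ (by linarith)).integrableOn (hi _ _ (by linarith)).integrableOn,
          integral_Ici_rpow (by linarith) _ ht0, integral_Ici_rpow hα _ ht0]
      rw [eq_neg_integral_Ici_of_tendsto_zero hf' hint hlim t, norm_neg]
      calc _ ≤ _ := norm_integral_le_of_norm_le
            ((hi (α + 1 + 1) (K * (1 + A)) (by linarith)).add
              (hi (α + 1) (K * B) (by linarith))).integrableOn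
            ((ae_restrict_iff' measurableSet_Ici).2 (Eventually.of_forall fun τ hτ => ?_))
        _ = _ := h1
        _ ≤ _ := ?_
      · have hτ0 : 0 < 1 + |τ| := by positivity
        have e : (1 + |τ|) ^ (-(α + 1)) = (1 + |τ|) ^ (-(α + 2)) * (1 + |τ|) := by
          rw [← rpow_add_one hτ0.ne']; ring_nf
        have h2 := hAB τ (ht.trans hτ)
        refine (hbd τ (ht0.trans hτ)).trans ?_
        simp only [Pi.add_apply]
        rw [show -(α + 1 + 1) = -(α + 2) by ring, e]
        have h3 : 0 ≤ K * (1 + |τ|) ^ (-(α + 2)) := by positivity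
        nlinarith
      · rw [abs_of_nonneg ht0]
        have h2 : (1 + t) ^ (-α) ≤ (1 + T) ^ (-α) :=
          rpow_le_rpow_of_nonpos (by linarith) (by linarith) (by linarith)
        have h3 : K * B / α * (1 + t) ^ (-α) ≤ B / 2 :=
          calc K * B / α * (1 + t) ^ (-α) ≤ K * B / α * (1 + T) ^ (-α) := by gcongr
            _ = B * (K / α * (1 + T) ^ (-α)) := by ring
            _ ≤ B * (1 / 2) := by gcongr
            _ = B / 2 := by ring
        have h4 : K * (1 + A) / (α + 1) ≤ K * (1 + A) :=
          div_le_self (by positivity) (by linarith)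
        have h5 : 0 ≤ (1 + t) ^ (-(α + 1)) := by positivity
        nlinarith
    intro t ht
    have ht0 : 0 ≤ t := hT0.trans ht
    have hBd : ∀ x ∈ Icc T t, HasDerivAt (fun x : ℝ => ‖f T‖ +
        (-(K * (1 + A) / α) * ((1 + x) ^ (-α) - (1 + T) ^ (-α)) + B / 2 * (x - T)))
        (K * (1 + A) * (1 + x) ^ (-(α + 1)) + B / 2) x := by
      intro x hx
      have h1 := ((hasDerivAt_one_add_rpow (hT0.trans hx.1) α).sub_const
        ((1 + T) ^ (-α))).const_mul (-(K * (1 + A) / α))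
      have h2 := ((hasDerivAt_id x).sub_const T).const_mul (B / 2)
      refine ((h1.add h2).const_add ‖f T‖).congr_deriv ?_
      field_simp
    have h := image_norm_le_of_norm_deriv_right_le_deriv_boundary' (a := T) (b := t)
      hcf.continuousOn (fun x _ => (hf x).hasDerivWithinAt) (by simp)
      (fun x hx => (hBd x hx).continuousAt.continuousWithinAt)
      (fun x hx => (hBd x (Ico_subset_Icc_self hx)).hasDerivWithinAt)
      (fun x hx => hf'bd x hx.1) (right_mem_Icc.2 ht)
    rw [abs_of_nonneg ht0]
    have h1 : 0 ≤ K * (1 + A) / α * (1 + t) ^ (-α) := by positivity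
    have h2 : K * (1 + A) / α * (1 + T) ^ (-α) ≤ (1 + A) / 2 := by
      calc _ = (1 + A) * (K / α * (1 + T) ^ (-α)) := by ring
        _ ≤ (1 + A) * (1 / 2) := by gcongr
        _ = (1 + A) / 2 := by ring
    nlinarith [mul_nonneg hB hT0]
  set D := 2 * (‖f T‖ + 1 / 2) + A with hD
  have iter : ∀ k : ℕ, ∀ t, T ≤ t → ‖f t‖ ≤ D + B * (1 / 2) ^ k * (1 + |t|) := by
    intro k
    induction k with
    | zero =>
      intro t ht
      have := hlin t (hT0.trans ht)
      have := norm_nonneg (f T)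
      simp only [pow_zero]
      linarith
    | succ k ih =>
      intro t ht
      have := step D _ (by positivity) (by positivity) ih t ht
      refine this.trans ?_
      rw [pow_succ]
      linarith
  have hlarge : ∀ t, T ≤ t → ‖f t‖ ≤ D := by
    intro t ht
    refine ge_of_tendsto' (x := atTop) (f := fun k : ℕ => D + B * (1 / 2) ^ k * (1 + |t|)) ?_
      (fun k => iter k t ht)
    have := ((tendsto_pow_atTop_nhds_zero_of_lt_one (r := (1 / 2 : ℝ)) (by norm_num)
      (by norm_num)).const_mul B).mul_const (1 + |t|)
    simpa using this.const_add D
  have hD0 : 0 ≤ D := by positivity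
  refine ⟨D + B * (1 + T), by positivity, fun t ht => ?_⟩
  rcases le_total T t with h | h
  · have := hlarge t h
    have : 0 ≤ B * (1 + T) := by positivity
    linarith
  · have h1 := hlin t ht
    rw [abs_of_nonneg ht] at h1
    have : B * (1 + t) ≤ B * (1 + T) := by gcongr
    have := norm_nonneg (f T)
    linarith

end Calculus

section Potential

variable {E : Type*} [NormedAddCommGroup E]

/-- In a cone around the line `t • w`, decay in space is decay in time. -/
theorem exists_one_add_norm_rpow_le [NormedSpace ℝ E] {w : E} (hw : w ≠ 0) {C s : ℝ}
    (hC : 0 ≤ C) (hs : 0 ≤ s) :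
    ∃ K, 0 ≤ K ∧ ∀ t : ℝ, ∀ u ∈ Metric.closedBall (t • w) (3 / 4 * ‖w‖ * |t| + C),
      (1 + ‖u‖) ^ (-s) ≤ K * (1 + |t|) ^ (-s) := by
  have hw0 : 0 < ‖w‖ := norm_pos_iff.2 hw
  set L := 1 + 4 * (1 + C) / ‖w‖ with hL
  have hL0 : 0 < L := by positivity
  refine ⟨L ^ s, by positivity, fun t u hu => ?_⟩
  rw [mem_closedBall_iff_norm] at hu
  have h1 : ‖t • w‖ ≤ ‖u‖ + ‖u - t • w‖ := norm_le_norm_add_norm_sub u (t • w)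
  rw [norm_smul, Real.norm_eq_abs] at h1
  have h2 : |t| ≤ 4 * (‖u‖ + C) / ‖w‖ := by
    rw [le_div_iff₀ hw0]; linarith
  have h3 : 1 + |t| ≤ L * (1 + ‖u‖) := by
    calc 1 + |t| ≤ 1 + 4 * (‖u‖ + C) / ‖w‖ := by gcongr
      _ ≤ (1 + ‖u‖) + 4 * ((1 + C) * (1 + ‖u‖)) / ‖w‖ := by
          have := norm_nonneg u
          gcongr
          · linarith
          · nlinarith [mul_nonneg hC this]
      _ = L * (1 + ‖u‖) := by rw [hL]; ring
  have h4 : (1 + |t|) ^ s ≤ L ^ s * (1 + ‖u‖) ^ s := by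
    rw [← mul_rpow hL0.le (by positivity)]
    exact rpow_le_rpow (by positivity) h3 hs
  rw [rpow_neg (by positivity), rpow_neg (by positivity), ← div_eq_mul_inv, ← one_div,
    div_le_div_iff₀ (by positivity) (by positivity)]
  linarith

theorem exists_norm_le_rpow_of_mem_cone [NormedSpace ℝ E] {E' : Type*} [NormedAddCommGroup E']
    {w : E} (hw : w ≠ 0) {C s β : ℝ} (hC : 0 ≤ C) (hs : 0 ≤ s) (hβ : 0 ≤ β) {f : E → E'}
    (hf : ∀ x, ‖f x‖ ≤ β * (1 + ‖x‖) ^ (-s)) :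
    ∃ K, 0 ≤ K ∧ ∀ t : ℝ, ∀ u ∈ Metric.closedBall (t • w) (3 / 4 * ‖w‖ * |t| + C),
      ‖f u‖ ≤ K * (1 + |t|) ^ (-s) := by
  obtain ⟨K, hK, h⟩ := exists_one_add_norm_rpow_le hw hC hs
  refine ⟨β * K, by positivity, fun t u hu => (hf u).trans ?_⟩
  rw [mul_assoc]
  gcongr
  exact h t u hu

variable [InnerProductSpace ℝ E] [CompleteSpace E] {V : E → ℝ}

theorem norm_gradient_sub (x y : E) :
    ‖gradient V x - gradient V y‖ = ‖fderiv ℝ V x - fderiv ℝ V y‖ := by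
  rw [gradient, gradient, ← map_sub, LinearIsometryEquiv.norm_map]

theorem continuous_gradient (hV : ContDiff ℝ 2 V) : Continuous (gradient V) :=
  (InnerProductSpace.toDual ℝ E).symm.continuous.comp (hV.continuous_fderiv (by norm_num))

theorem exists_norm_gradient_sub_le_of_mem_cone (hV : ContDiff ℝ 2 V) {w : E} (hw : w ≠ 0)
    {C s β : ℝ} (hC : 0 ≤ C) (hs : 0 ≤ s) (hβ : 0 ≤ β)
    (hf : ∀ x, ‖iteratedFDeriv ℝ 2 V x‖ ≤ β * (1 + ‖x‖) ^ (-s)) :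
    ∃ K, 0 ≤ K ∧ ∀ t : ℝ, ∀ x ∈ Metric.closedBall (t • w) (3 / 4 * ‖w‖ * |t| + C),
      ∀ y ∈ Metric.closedBall (t • w) (3 / 4 * ‖w‖ * |t| + C),
        ‖gradient V x - gradient V y‖ ≤ K * (1 + |t|) ^ (-s) * ‖x - y‖ := by
  obtain ⟨K, hK, h⟩ := exists_norm_le_rpow_of_mem_cone hw hC hs hβ hf
  refine ⟨K, hK, fun t x hx y hy => ?_⟩
  rw [norm_gradient_sub]
  refine (convex_closedBall _ _).norm_image_sub_le_of_norm_fderiv_le (𝕜 := ℝ)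
    (fun u _ => ((hV.fderiv_right (m := 1) (by norm_num)).differentiable (by norm_num)) u)
    (fun u hu => ?_) hy hx
  rw [← norm_iteratedFDeriv_one, norm_iteratedFDeriv_fderiv]
  exact h t u hu

/-- Energy conservation: a trajectory escaping to regions of vanishing potential at both ends has
the same asymptotic speed in the past and in the future. -/
theorem norm_eq_of_energy_conservation {F : E → E} (hV : ∀ y, HasGradientAt V (-F y) y)
    {x x' : ℝ → E} {v a : E} (hx : ∀ t, HasDerivAt x (x' t) t)
    (hx' : ∀ t, HasDerivAt x' (F (x t)) t)
    (hVbot : Tendsto (V ∘ x) atBot (𝓝 0)) (hVtop : Tendsto (V ∘ x) atTop (𝓝 0))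
    (hbot : Tendsto x' atBot (𝓝 v)) (htop : Tendsto x' atTop (𝓝 a)) : ‖a‖ = ‖v‖ := by
  have hd : ∀ t, HasDerivAt (fun t => ‖x' t‖ ^ 2 + 2 * V (x t)) 0 t := by
    intro t
    have h1 := (hV (x t)).hasFDerivAt.comp_hasDerivAt t (hx t)
    refine ((hx' t).norm_sq.add (h1.const_mul 2)).congr_deriv ?_
    rw [InnerProductSpace.toDual_apply_apply, inner_neg_left, real_inner_comm]
    ring
  have hconst : ∀ s t, ‖x' s‖ ^ 2 + 2 * V (x s) = ‖x' t‖ ^ 2 + 2 * V (x t) :=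
    is_const_of_deriv_eq_zero (fun t => (hd t).differentiableAt) (fun t => (hd t).deriv)
  have h1 : Tendsto (fun t => ‖x' t‖ ^ 2 + 2 * V (x t)) atBot (𝓝 (‖v‖ ^ 2)) := by
    simpa using (hbot.norm.pow 2).add (hVbot.const_mul 2)
  have h2 : Tendsto (fun t => ‖x' t‖ ^ 2 + 2 * V (x t)) atTop (𝓝 (‖a‖ ^ 2)) := by
    simpa using (htop.norm.pow 2).add (hVtop.const_mul 2)
  have e : (fun t => ‖x' t‖ ^ 2 + 2 * V (x t)) = fun _ => ‖x' 0‖ ^ 2 + 2 * V (x 0) :=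
    funext fun t => hconst t 0
  rw [e] at h1 h2
  have := (tendsto_nhds_unique h2 tendsto_const_nhds).trans
    (tendsto_nhds_unique tendsto_const_nhds h1)
  exact (pow_left_inj₀ (norm_nonneg _) (norm_nonneg _) two_ne_zero).1 this

end Potential

theorem MemM.norm_le {n : ℕ} {r : ℝ} {f : ℝ → Euc n} (hf : MemM r f) :
    (∀ t ≤ 0, ‖f t‖ ≤ r) ∧ ∀ t, 0 ≤ t → ‖f t‖ ≤ r * (1 + t) := by
  obtain ⟨-, h1, h2, h3⟩ := hf
  have p1 : 0 ≤ sSup ((fun t => ‖f t‖) '' Iic 0) :=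
    Real.sSup_nonneg (by rintro _ ⟨t, -, rfl⟩; exact norm_nonneg _)
  have p2 : 0 ≤ sSup ((fun t => ‖f t‖ / (1 + t)) '' Ici 0) := by
    refine Real.sSup_nonneg ?_
    rintro _ ⟨t, ht, rfl⟩
    have : 0 ≤ t := ht
    positivity
  rw [Mnorm] at h3
  refine ⟨fun t ht => ?_, fun t ht => ?_⟩
  · have := le_csSup h1 ⟨t, ht, rfl⟩
    simp only at this
    linarith
  · have := le_csSup h2 ⟨t, ht, rfl⟩
    rw [← div_le_iff₀ (by linarith)]
    simp only at this
    linarith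

theorem growth_constant_le {n : ℕ} {α β₁ β₂ v : ℝ} (hα : 0 < α) (hβ₁ : 0 < β₁) (hv0 : 0 < v)
    (hv : √(2 ^ 5 * (n : ℝ) * max β₁ β₂ / α) ≤ v) :
    2 ^ ((5 : ℝ) / 2) * √n * β₁ / (α * v) ≤ v / 4 := by
  have h1 : 2 ^ 5 * (n : ℝ) * max β₁ β₂ / α ≤ v ^ 2 := (Real.sqrt_le_left hv0.le).1 hv
  have h2 : (2 : ℝ) ^ ((5 : ℝ) / 2) ≤ 8 :=
    (rpow_le_rpow_of_exponent_le (by norm_num) (by norm_num : (5 : ℝ) / 2 ≤ (3 : ℕ))).trans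
      (by rw [rpow_natCast]; norm_num)
  have h3 : √(n : ℝ) ≤ n := by
    rw [Real.sqrt_le_left (by positivity)]
    rcases Nat.eq_zero_or_pos n with rfl | hn
    · simp
    · have : (1 : ℝ) ≤ n := by exact_mod_cast hn
      nlinarith
  rw [div_le_iff₀ hα] at h1
  rw [div_le_iff₀ (by positivity)]
  calc 2 ^ ((5 : ℝ) / 2) * √n * β₁ ≤ 8 * n * max β₁ β₂ := by
        gcongr
        exact le_max_left _ _
    _ ≤ v / 4 * (α * v) := by linarith

set_option maxHeartbeats 1000000 in
theorem statement_4
    (n : ℕ) (hn : 2 ≤ n) (α : ℝ) (hα0 : 0 < α) (hα1 : α ≤ 1)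
    (Vl Vs : Euc n → ℝ) (βl0 βl1 βl2 βs1 βs2 βs3 : ℝ)
    (hβl0 : 0 < βl0) (hβl1 : 0 < βl1) (hβl2 : 0 < βl2)
    (hβs1 : 0 < βs1) (hβs2 : 0 < βs2) (hβs3 : 0 < βs3)
    (hVl : LongRange α βl0 βl1 βl2 Vl) (hVs : ShortRange α βs1 βs2 βs3 Vs)
    (Fl Fs F : Euc n → Euc n)
    (hFl : ∀ y, Fl y = -gradient Vl y) (hFs : ∀ y, Fs y = -gradient Vs y)
    (hF : ∀ y, F y = Fl y + Fs y)
    (vm xm : Euc n) (hperp : ⟪vm, xm⟫ = 0) (hvm : Real.sqrt (2 ^ 5 * (n : ℝ) * max βl1 βl2 / α) ≤ ‖vm‖)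
    (zm : ℝ → Euc n) (hzm : IsFreeSol Fl 0 vm atBot (2 ^ ((5:ℝ)/2) * Real.sqrt n * βl1 / (α * ‖vm‖)) zm)
    (r : ℝ) (hr0 : 0 < r) (hr : r < min (‖vm‖ / 2 ^ ((3:ℝ)/2)) 1)
    (ym : ℝ → Euc n) (hym : MemM r ym) (hfix : Aop Fl F zm xm ym = ym)
    (a : Euc n) (ha : a = vm + ∫ τ : ℝ, F (zm τ + xm + ym τ))
    (zp : ℝ → Euc n) (hzp : IsFreeSol Fl 0 a atTop
      (2 ^ ((5:ℝ)/2) * Real.sqrt n * βl1 / (α * ‖a‖)) zp) :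
    (ContDiff ℝ 2 (fun t => zm t + xm + ym t) ∧
      ∀ t, deriv (deriv (fun t => zm t + xm + ym t)) t = F (zm t + xm + ym t)) ∧
    (Integrable (fun τ => F (zm τ + xm + ym τ)) ∧ ‖a‖ = ‖vm‖) ∧
    (∀ σ : ℝ, IntegrableOn (fun τ => F (zm τ + xm + ym τ) - Fl (zm τ)) (Iic σ)) ∧
    IntegrableOn (fun σ => ∫ τ in Iic σ, (F (zm τ + xm + ym τ) - Fl (zm τ))) (Iic 0) ∧
    (∀ σ : ℝ, IntegrableOn (fun τ => Fs (zm τ + xm + ym τ)) (Ici σ)) ∧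
    IntegrableOn (fun σ => ∫ τ in Ici σ, Fs (zm τ + xm + ym τ)) (Ici 0) ∧
    (∀ σ : ℝ, IntegrableOn (fun τ => Fl (zp τ + xm) - Fl (zp τ)) (Ici σ)) ∧
    IntegrableOn (fun σ => ∫ τ in Ici σ, (Fl (zp τ + xm) - Fl (zp τ))) (Ici 0) ∧
    (∀ σ : ℝ, IntegrableOn (fun τ => Fl (zm τ + xm + ym τ) - Fl (zp τ + xm)) (Ici σ)) ∧
    IntegrableOn (fun σ => ∫ τ in Ici σ, (Fl (zm τ + xm + ym τ) - Fl (zp τ + xm))) (Ici 0) ∧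
    (∀ σ : ℝ, IntegrableOn (fun τ => F (zm τ + xm + ym τ) - Fl (zp τ)) (Ici σ)) ∧
    (∀ t : ℝ, 0 ≤ t →
      IntegrableOn (fun σ => ∫ τ in Ici σ, (F (zm τ + xm + ym τ) - Fl (zp τ))) (Ici t)) ∧
    (∀ t : ℝ, 0 ≤ t →
      zm t + xm + ym t =
        zp t + (xm + lInt Fl Fs F zm xm ym + l1Int Fl zp xm + l2Int Fl zm zp xm ym) +
          yplusInt Fl F zm zp xm ym t) := by
  obtain ⟨hVlc, hVl0, hVl1, hVl2⟩ := hVl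
  obtain ⟨hVsc, hVs0, hVs1, hVs2⟩ := hVs
  obtain ⟨hzmc, hzmF, hzm0, hzmlim, hzmbd⟩ := hzm
  obtain ⟨hzpc, hzpF, hzp0, hzplim, hzpbd⟩ := hzp
  have hFlc : Continuous Fl := by
    rw [funext hFl]
    exact (continuous_gradient hVlc).neg
  have hFsc : Continuous Fs := by
    rw [funext hFs]
    exact (continuous_gradient hVsc).neg
  have hFc : Continuous F := by
    rw [funext hF]
    exact hFlc.add hFsc
  have hFlsub : ∀ y y', ‖Fl y - Fl y'‖ = ‖gradient Vl y - gradient Vl y'‖ := fun y y' => by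
    rw [hFl, hFl, neg_sub_neg, norm_sub_rev]
  have hv0 : 0 < ‖vm‖ := by
    have : (0 : ℝ) < n := by exact_mod_cast (by omega : 0 < n)
    have : 0 < max βl1 βl2 := lt_max_of_lt_left hβl1
    exact (Real.sqrt_pos.2 (by positivity)).trans_le hvm
  have hvne : vm ≠ 0 := norm_pos_iff.1 hv0
  have hrv : r ≤ ‖vm‖ / 2 := by
    have h1 : (2 : ℝ) ≤ 2 ^ ((3 : ℝ) / 2) := by
      simpa using rpow_le_rpow_of_exponent_le (x := 2) (by norm_num)
        (by norm_num : (1 : ℝ) ≤ 3 / 2)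
    exact (hr.trans_le (min_le_left _ _)).le.trans (by gcongr)
  obtain ⟨hym1, hym2⟩ := hym.norm_le
  have hymc : Continuous ym := hym.1
  obtain ⟨x, hx⟩ : ∃ x : ℝ → Euc n, ∀ t, zm t + xm + ym t = x t := ⟨_, fun _ => rfl⟩
  simp only [lInt, l1Int, l2Int, yplusInt, hx]
  simp only [hx] at ha
  have hxc : Continuous x := by
    rw [← funext hx]
    exact (hzmc.continuous.add continuous_const).add hymc
  have hymI : ∀ t, ym t = ∫ σ in Iic t, ∫ τ in Iic σ, (F (x τ) - Fl (zm τ)) := fun t => by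
    conv_lhs => rw [← hfix]
    simp only [Aop, hx]
  -- the incoming free solution and the perturbed trajectory stay in a cone around `t • vm`
  have hC0 : 0 ≤ ‖xm‖ + r := by positivity
  have hzmcone : ∀ t, zm t ∈ Metric.closedBall (t • vm) (3 / 4 * ‖vm‖ * |t| + (‖xm‖ + r)) := by
    intro t
    rw [mem_closedBall_iff_norm]
    have h1 := hzmbd t
    rw [sub_zero] at h1
    have h2 := growth_constant_le (n := n) hα0 hβl1 hv0 hvm
    have h3 := mul_le_mul_of_nonneg_right h2 (abs_nonneg t)
    have h4 := mul_nonneg hv0.le (abs_nonneg t)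
    linarith
  have hxcone : ∀ t, x t ∈ Metric.closedBall (t • vm) (3 / 4 * ‖vm‖ * |t| + (‖xm‖ + r)) := by
    intro t
    rw [mem_closedBall_iff_norm, ← hx]
    have h1 := hzmbd t
    rw [sub_zero] at h1
    have h2 := growth_constant_le (n := n) hα0 hβl1 hv0 hvm
    have h3 := mul_le_mul_of_nonneg_right h2 (abs_nonneg t)
    have h4 : ‖ym t‖ ≤ r + ‖vm‖ / 2 * |t| := by
      rcases le_total t 0 with ht | ht
      · have := hym1 t ht
        have : 0 ≤ ‖vm‖ / 2 * |t| := by positivity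
        linarith
      · rw [abs_of_nonneg ht]
        have := hym2 t ht
        have := mul_le_mul_of_nonneg_right hrv ht
        linarith
    have h5 : zm t + xm + ym t - t • vm = (zm t - t • vm) + (xm + ym t) := by abel
    rw [h5]
    have h6 := norm_add_le (zm t - t • vm) (xm + ym t)
    have h7 := norm_add_le xm (ym t)
    linarith
  obtain ⟨K₁, hK₁, hFlbd⟩ := exists_norm_le_rpow_of_mem_cone hvne hC0 (by linarith) hβl1.le
    (s := α + 1) (f := Fl) (fun y => by rw [hFl, norm_neg]; exact hVl1 y)
  obtain ⟨K₂, hK₂, hFsbd⟩ := exists_norm_le_rpow_of_mem_cone hvne hC0 (by linarith) hβs2.le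
    (s := α + 2) (f := Fs) (fun y => by rw [hFs, norm_neg]; exact hVs1 y)
  obtain ⟨K₃, hK₃, hFllip⟩ := exists_norm_gradient_sub_le_of_mem_cone (s := α + 2) hVlc hvne hC0
    (by linarith) hβl2.le hVl2
  -- the equation of motion
  have hgc : Continuous fun τ => F (x τ) - Fl (zm τ) :=
    (hFc.comp hxc).sub (hFlc.comp hzmc.continuous)
  have hgbd : ∀ t ≤ 0, ‖F (x t) - Fl (zm t)‖ ≤
      (K₃ * (‖xm‖ + r) + K₂) * (1 + |t|) ^ (-(α + 2)) := by
    intro t ht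
    have h1 := hFllip t _ (hxcone t) _ (hzmcone t)
    rw [← hFlsub] at h1
    have h2 := hFsbd t _ (hxcone t)
    have h3 : ‖x t - zm t‖ ≤ ‖xm‖ + r := by
      rw [← hx, show zm t + xm + ym t - zm t = xm + ym t by abel]
      exact (norm_add_le _ _).trans (by gcongr; exact hym1 t ht)
    have h4 : F (x t) - Fl (zm t) = (Fl (x t) - Fl (zm t)) + Fs (x t) := by rw [hF]; abel
    rw [h4]
    calc _ ≤ _ := norm_add_le _ _
      _ ≤ K₃ * (1 + |t|) ^ (-(α + 2)) * (‖xm‖ + r) + K₂ * (1 + |t|) ^ (-(α + 2)) := by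
          refine add_le_add (h1.trans ?_) h2
          gcongr
      _ = _ := by ring
  have hgi := integrableOn_Iic_of_norm_le_rpow hgc (by linarith) hgbd
  have hGi := integrableOn_Iic_integral_Iic hgc (by linarith) hgbd
  have hGc := continuous_integral_Iic hgc hgi
  have hderiv2 : ∀ {z : ℝ → Euc n}, ContDiff ℝ 2 z → (∀ t, deriv (deriv z) t = Fl (z t)) →
      (∀ t, HasDerivAt z (deriv z t) t) ∧ ∀ t, HasDerivAt (deriv z) (Fl (z t)) t := by
    intro z hz hzF
    have h1 : ContDiff ℝ 1 (deriv z) := by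
      rw [show (2 : WithTop ℕ∞) = 1 + 1 by norm_num, contDiff_succ_iff_deriv] at hz
      exact hz.2.2
    exact ⟨fun t => (hz.differentiable (by norm_num) t).hasDerivAt,
      fun t => hzF t ▸ (h1.differentiable (by norm_num) t).hasDerivAt⟩
  obtain ⟨hzm', hzm''⟩ := hderiv2 hzmc hzmF
  obtain ⟨hzp', hzp''⟩ := hderiv2 hzpc hzpF
  obtain ⟨x', hx'⟩ : ∃ x' : ℝ → Euc n, ∀ t,
    deriv zm t + (∫ τ in Iic t, (F (x τ) - Fl (zm τ))) = x' t := ⟨_, fun _ => rfl⟩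
  have hxd : ∀ t, HasDerivAt x (x' t) t := by
    intro t
    have h1 := hasDerivAt_integral_Iic hGc hGi t
    rw [← funext hymI] at h1
    exact ((((hzm' t).add_const xm).add h1).congr_of_eventuallyEq
      (Eventually.of_forall fun s => (hx s).symm)).congr_deriv (hx' t)
  have hxd' : ∀ t, HasDerivAt x' (F (x t)) t := by
    intro t
    rw [← funext hx']
    exact ((hzm'' t).add (hasDerivAt_integral_Iic hgc hgi t)).congr_deriv (by simp)
  -- asymptotic velocities
  have hFbd : ∀ t, ‖F (x t)‖ ≤ (K₁ + K₂) * (1 + |t|) ^ (-(α + 1)) := by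
    intro t
    have h1 := hFlbd t _ (hxcone t)
    have h2 := hFsbd t _ (hxcone t)
    have h3 : (1 + |t|) ^ (-(α + 2)) ≤ (1 + |t|) ^ (-(α + 1)) :=
      rpow_le_rpow_of_exponent_le (by linarith [abs_nonneg t]) (by linarith)
    rw [hF, add_mul]
    exact (norm_add_le _ _).trans (add_le_add h1 (h2.trans (by gcongr)))
  have hFint : Integrable fun t => F (x t) :=
    integrable_of_norm_le_rpow (hFc.comp hxc) (by linarith) hFbd
  have hbot : Tendsto x' atBot (𝓝 vm) := by
    rw [← funext hx']
    simpa using hzmlim.add (tendsto_integral_Iic_atBot (by linarith) hgbd)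
  have htop : Tendsto x' atTop (𝓝 a) := by
    have h1 := tendsto_limUnder_of_hasDerivAt_of_integrableOn_Ioi (a := 0)
      (fun t _ => hxd' t) hFint.integrableOn
    have h2 := integral_of_hasDerivAt_of_tendsto hxd' hFint hbot h1
    rw [h2, add_sub_cancel] at ha
    rwa [ha]
  have hVbd : ∀ {l : Filter ℝ}, Tendsto (|·|) l atTop →
      Tendsto ((fun y => Vl y + Vs y) ∘ x) l (𝓝 0) := by
    obtain ⟨K₄, -, h1⟩ := exists_norm_le_rpow_of_mem_cone hvne hC0 hα0.le hβl0.le (s := α)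
      (f := Vl) hVl0
    obtain ⟨K₅, -, h2⟩ := exists_norm_le_rpow_of_mem_cone hvne hC0 (by linarith) hβs1.le
      (s := α + 1) (f := Vs) hVs0
    intro l hl
    have h3 := squeeze_zero_norm (fun t => h1 t _ (hxcone t))
      (by simpa using (tendsto_one_add_abs_rpow hα0 hl).const_mul K₄)
    have h4 := squeeze_zero_norm (fun t => h2 t _ (hxcone t))
      (by simpa using (tendsto_one_add_abs_rpow (s := α + 1) (by linarith) hl).const_mul K₅)
    simpa [Function.comp_def] using h3.add h4
  have hgrad : ∀ y, HasGradientAt (fun y => Vl y + Vs y) (-F y) y := by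
    intro y
    have h1 := (hVlc.differentiable (by norm_num) y).hasGradientAt.hasFDerivAt
    have h2 := (hVsc.differentiable (by norm_num) y).hasGradientAt.hasFDerivAt
    rw [hasGradientAt_iff_hasFDerivAt, hF, hFl, hFs]
    refine (h1.add h2).congr_fderiv ?_
    rw [← map_add]
    congr 1
    abel
  have hav : ‖a‖ = ‖vm‖ := norm_eq_of_energy_conservation hgrad hxd hxd'
    (hVbd tendsto_abs_atBot_atTop) (hVbd tendsto_abs_atTop_atTop) hbot htop
  -- the outgoing free solution and the perturbed trajectory stay in a cone around `t • a`
  have ha0 : 0 < ‖a‖ := hav ▸ hv0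
  have hane : a ≠ 0 := norm_pos_iff.1 ha0
  obtain ⟨C, hC, hxa⟩ := exists_norm_sub_smul_le_of_tendsto (ε := ‖a‖ / 4) (by positivity)
    hxd htop
  have hzpa : ∀ t, ‖zp t - t • a‖ ≤ ‖a‖ / 4 * |t| := by
    intro t
    have h1 := hzpbd t
    rw [sub_zero] at h1
    exact h1.trans (mul_le_mul_of_nonneg_right
      (growth_constant_le hα0 hβl1 ha0 (hav ▸ hvm)) (abs_nonneg t))
  have hC1 : 0 ≤ C + ‖xm‖ := by positivity
  have hxcone' : ∀ t, 0 ≤ t →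
      x t ∈ Metric.closedBall (t • a) (3 / 4 * ‖a‖ * |t| + (C + ‖xm‖)) := by
    intro t ht
    rw [mem_closedBall_iff_norm]
    have := hxa t ht
    have := mul_nonneg ha0.le (abs_nonneg t)
    linarith [norm_nonneg xm]
  have hzpcone : ∀ t, zp t ∈ Metric.closedBall (t • a) (3 / 4 * ‖a‖ * |t| + (C + ‖xm‖)) := by
    intro t
    rw [mem_closedBall_iff_norm]
    have := hzpa t
    have := mul_nonneg ha0.le (abs_nonneg t)
    linarith [norm_nonneg xm]
  have hzpcone' : ∀ t,
      zp t + xm ∈ Metric.closedBall (t • a) (3 / 4 * ‖a‖ * |t| + (C + ‖xm‖)) := by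
    intro t
    rw [mem_closedBall_iff_norm, add_sub_right_comm]
    have := hzpa t
    have := mul_nonneg ha0.le (abs_nonneg t)
    linarith [norm_add_le (zp t - t • a) xm]
  obtain ⟨K₆, hK₆, hFsbd'⟩ := exists_norm_le_rpow_of_mem_cone hane hC1 (by linarith) hβs2.le
    (s := α + 2) (f := Fs) (fun y => by rw [hFs, norm_neg]; exact hVs1 y)
  obtain ⟨K₇, hK₇, hFllip'⟩ := exists_norm_gradient_sub_le_of_mem_cone (s := α + 2) hVlc hane hC1
    (by linarith) hβl2.le hVl2
  simp only [← hFlsub] at hFllip'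
  -- the perturbed trajectory stays at bounded distance from the outgoing free solution
  have hzpcont : Continuous zp := hzpc.continuous
  have hdd : ∀ t, HasDerivAt (fun t => x t - zp t) (x' t - deriv zp t) t :=
    fun t => (hxd t).sub (hzp' t)
  have hdd' : ∀ t, HasDerivAt (fun t => x' t - deriv zp t) (F (x t) - Fl (zp t)) t :=
    fun t => (hxd' t).sub (hzp'' t)
  have hqc : Continuous fun t => F (x t) - Fl (zp t) :=
    (hFc.comp hxc).sub (hFlc.comp hzpcont)
  have hlim0 : Tendsto (fun t => x' t - deriv zp t) atTop (𝓝 0) := by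
    simpa using htop.sub hzplim
  obtain ⟨D, hD, hdist⟩ : ∃ D, 0 ≤ D ∧ ∀ t, 0 ≤ t → ‖x t - zp t‖ ≤ D := by
    refine exists_norm_le_of_second_deriv_le (A := C) (B := ‖a‖) (K := K₇ + K₆) hα0 hdd hdd'
      hqc hlim0 hC ha0.le (by positivity) (fun t ht => ?_) (fun t ht => ?_)
    · have h1 := norm_sub_le_norm_sub_add_norm_sub (x t) (t • a) (zp t)
      rw [norm_sub_rev (t • a)] at h1
      have := hxa t ht
      have := hzpa t
      have := mul_nonneg ha0.le (abs_nonneg t)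
      linarith
    · have h1 := hFllip' t _ (hxcone' t ht) _ (hzpcone t)
      have h2 := hFsbd' t _ (hxcone' t ht)
      rw [hF, add_sub_right_comm]
      have h3 : 0 ≤ K₇ * (1 + |t|) ^ (-(α + 2)) := by positivity
      have h4 : 0 ≤ K₆ * (1 + |t|) ^ (-(α + 2)) * ‖x t - zp t‖ := by positivity
      calc _ ≤ _ := norm_add_le _ _
        _ ≤ _ := add_le_add h1 h2
        _ ≤ _ := by linarith
  -- convergence of the outgoing integrals
  have hp1 : 1 < α + 2 := by linarith
  have hp2 : 2 < α + 2 := by linarith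
  have hsc : Continuous fun t => Fs (x t) := hFsc.comp hxc
  have hsbd : ∀ t, 0 ≤ t → ‖Fs (x t)‖ ≤ K₆ * (1 + |t|) ^ (-(α + 2)) :=
    fun t ht => hFsbd' t _ (hxcone' t ht)
  have h1c : Continuous fun t => Fl (zp t + xm) - Fl (zp t) :=
    (hFlc.comp (hzpcont.add continuous_const)).sub (hFlc.comp hzpcont)
  have h1bd : ∀ t, 0 ≤ t → ‖Fl (zp t + xm) - Fl (zp t)‖ ≤
      K₇ * ‖xm‖ * (1 + |t|) ^ (-(α + 2)) := by
    intro t _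
    have h := hFllip' t _ (hzpcone' t) _ (hzpcone t)
    rw [add_sub_cancel_left] at h
    linarith
  have h2c : Continuous fun t => Fl (x t) - Fl (zp t + xm) :=
    (hFlc.comp hxc).sub (hFlc.comp (hzpcont.add continuous_const))
  have h2bd : ∀ t, 0 ≤ t → ‖Fl (x t) - Fl (zp t + xm)‖ ≤
      K₇ * (D + ‖xm‖) * (1 + |t|) ^ (-(α + 2)) := by
    intro t ht
    have h := hFllip' t _ (hxcone' t ht) _ (hzpcone' t)
    have h3 : ‖x t - (zp t + xm)‖ ≤ D + ‖xm‖ := by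
      rw [← sub_sub]
      exact (norm_sub_le _ _).trans (by gcongr; exact hdist t ht)
    calc _ ≤ _ := h
      _ ≤ K₇ * (1 + |t|) ^ (-(α + 2)) * (D + ‖xm‖) := by gcongr
      _ = _ := by ring
  have hqsplit : ∀ t, F (x t) - Fl (zp t) =
      Fs (x t) + ((Fl (zp t + xm) - Fl (zp t)) + (Fl (x t) - Fl (zp t + xm))) := by
    intro t
    rw [hF]
    abel
  have hqbd : ∀ t, 0 ≤ t → ‖F (x t) - Fl (zp t)‖ ≤
      (K₆ + (K₇ * ‖xm‖ + K₇ * (D + ‖xm‖))) * (1 + |t|) ^ (-(α + 2)) := by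
    intro t ht
    rw [hqsplit, add_mul, add_mul]
    exact (norm_add_le _ _).trans (add_le_add (hsbd t ht)
      ((norm_add_le _ _).trans (add_le_add (h1bd t ht) (h2bd t ht))))
  have hsi := integrableOn_Ici_of_norm_le_rpow hsc hp1 hsbd
  have hSi := integrableOn_Ici_integral_Ici hsc hp2 hsbd
  have h1i := integrableOn_Ici_of_norm_le_rpow h1c hp1 h1bd
  have h1I := integrableOn_Ici_integral_Ici h1c hp2 h1bd
  have h2i := integrableOn_Ici_of_norm_le_rpow h2c hp1 h2bd
  have h2I := integrableOn_Ici_integral_Ici h2c hp2 h2bd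
  have hqi := integrableOn_Ici_of_norm_le_rpow hqc hp1 hqbd
  have hqI := integrableOn_Ici_integral_Ici hqc hp2 hqbd
  refine ⟨⟨contDiff_two_of_hasDerivAt hxd hxd' (hFc.comp hxc), fun t => ?_⟩, ⟨hFint, hav⟩, hgi,
    hGi 0, hsi, hSi 0, h1i, h1I 0, h2i, h2I 0, hqi, fun t _ => hqI t, fun t _ => ?_⟩
  · rw [show deriv (fun t => x t) = x' from funext fun t => (hxd t).deriv]
    exact (hxd' t).deriv
  · have hcd : ∀ t, HasDerivAt (fun t => (x t - zp t) -
        ∫ σ in Ici t, ∫ τ in Ici σ, (F (x τ) - Fl (zp τ))) 0 t := by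
      intro t
      refine ((hdd t).sub (hasDerivAt_integral_Ici (continuous_integral_Ici hqc hqi)
        hqI t)).congr_deriv ?_
      rw [eq_neg_integral_Ici_of_tendsto_zero hdd' hqi hlim0 t, sub_self]
    have hconst := is_const_of_deriv_eq_zero (fun t => (hcd t).differentiableAt)
      (fun t => (hcd t).deriv) t 0
    have hinner : ∀ σ, ∫ τ in Ici σ, (F (x τ) - Fl (zp τ)) =
        (∫ τ in Ici σ, Fs (x τ)) + ((∫ τ in Ici σ, (Fl (zp τ + xm) - Fl (zp τ))) +
          ∫ τ in Ici σ, (Fl (x τ) - Fl (zp τ + xm))) := by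
      intro σ
      simp only [hqsplit]
      exact integral_add_add (hsi σ) (h1i σ) (h2i σ)
    have houter : ∫ σ in Ici (0 : ℝ), ∫ τ in Ici σ, (F (x τ) - Fl (zp τ)) =
        (∫ σ in Ici (0 : ℝ), ∫ τ in Ici σ, Fs (x τ)) +
          ((∫ σ in Ici (0 : ℝ), ∫ τ in Ici σ, (Fl (zp τ + xm) - Fl (zp τ))) +
            ∫ σ in Ici (0 : ℝ), ∫ τ in Ici σ, (Fl (x τ) - Fl (zp τ + xm))) := by
      simp only [hinner]
      exact integral_add_add (hSi 0) (h1I 0) (h2I 0)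
    have hx0 : x 0 = xm + ym 0 := by rw [← hx, hzm0, zero_add]
    rw [houter, hx0, hzp0, hymI 0, sub_zero] at hconst
    rw [eq_add_of_sub_eq (eq_add_of_sub_eq hconst)]
    abel

end Paper
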